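/- arXiv:2309.03810 — 2 statements merged into one kernel-verified Lean document; each statement's English description precedes it below -/
import Mathlib

section
/- Let G be a 3-regular finite simple graph on n vertices (so n is even, n ≥ 4), and let q be any natural number with q ≥ 3n + 4. Then δ_edit(G[q], D_{n,q}) ≤ n if and only if G has a Hamiltonian cycle. -/
open SimpleGraph

section MismatchDefs

variable {V W : Type*}

/-- The mismatch graph `G^π − H`: the symmetric difference of the image of `G` under the
bijection `π` with `H`, as a graph on `V(H)`. Its edges are the positive edges
(edges of `G^π` not in `H`) together with the negative edges (edges of `H` not in `G^π`). -/
def mismatchGraph (G : SimpleGraph V) (H : SimpleGraph W) (π : V ≃ W) : SimpleGraph W :=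
  symmDiff (G.map π.toEmbedding) H

/-- The degree of a vertex in the mismatch graph `G^π − H`. -/
noncomputable def mismatchDeg (G : SimpleGraph V) (H : SimpleGraph W) (π : V ≃ W) (x : W) : ℕ :=
  ((mismatchGraph G H π).neighborSet x).ncard

/-- The number of positive edges of `G^π − H` incident to `x`. -/
noncomputable def posDeg (G : SimpleGraph V) (H : SimpleGraph W) (π : V ≃ W) (x : W) : ℕ :=
  ((G.map π.toEmbedding).neighborSet x \ H.neighborSet x).ncard

/-- The number of negative edges of `G^π − H` incident to `x`. -/
noncomputable def negDeg (G : SimpleGraph V) (H : SimpleGraph W) (π : V ≃ W) (x : W) : ℕ :=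
  (H.neighborSet x \ (G.map π.toEmbedding).neighborSet x).ncard

/-- The maximum mismatch count `MMC(π)`: the maximum degree of the mismatch graph `G^π − H`. -/
noncomputable def MMC [Fintype W] (G : SimpleGraph V) (H : SimpleGraph W) (π : V ≃ W) : ℕ :=
  Finset.univ.sup (mismatchDeg G H π)

/-- The edit mismatch norm `μ_edit(G^π, H)`: the number of edges of the mismatch graph. -/
noncomputable def muEdit (G : SimpleGraph V) (H : SimpleGraph W) (π : V ≃ W) : ℕ :=
  (mismatchGraph G H π).edgeSet.ncard

/-- The edit distance `δ_edit(G, H)`: the minimum of `μ_edit(G^π, H)` over all bijections. -/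
noncomputable def deltaEdit (G : SimpleGraph V) (H : SimpleGraph W) : ℕ :=
  ⨅ π : V ≃ W, muEdit G H π

open Classical in
/-- The signed adjacency matrix of the mismatch graph `G^π − H`:
`+1` on positive edges, `−1` on negative edges, `0` otherwise. -/
noncomputable def signedAdj (G : SimpleGraph V) (H : SimpleGraph W) (π : V ≃ W) :
    Matrix W W ℝ := fun x y =>
  if (G.map π.toEmbedding).Adj x y ∧ ¬ H.Adj x y then 1
  else if H.Adj x y ∧ ¬ (G.map π.toEmbedding).Adj x y then -1 else 0

/-- The `ℓ_p` norm of a vector over a finite index type. -/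
noncomputable def lpNorm [Fintype W] (p : ℝ) (x : W → ℝ) : ℝ :=
  (∑ i, |x i| ^ p) ^ p⁻¹

/-- The `ℓ_p`-operator norm of a matrix: `sup_{x ≠ 0} ‖Mx‖_p / ‖x‖_p`. -/
noncomputable def lpOpNorm [Fintype W] (p : ℝ) (M : Matrix W W ℝ) : ℝ :=
  ⨆ x : {x : W → ℝ // x ≠ 0}, lpNorm p (M.mulVec x.1) / lpNorm p x.1

end MismatchDefs

/-- `G[q]`: attach an auxiliary `(q+1)`-clique to each vertex `v` of `G`.
The clique vertices of `v` are `Sum.inr (v, i)` for `i : Fin (q+1)`; the clique is joined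
to `v` via the edge `{v^[1], v}`, where `v^[1]` is `Sum.inr (v, 0)`. -/
def extendCliques {V : Type*} (G : SimpleGraph V) (q : ℕ) :
    SimpleGraph (V ⊕ V × Fin (q + 1)) :=
  SimpleGraph.fromRel (fun a b =>
    match a, b with
    | Sum.inl u, Sum.inl v => G.Adj u v
    | Sum.inl u, Sum.inr (v, i) => u = v ∧ i = 0
    | Sum.inr _, Sum.inl _ => False
    | Sum.inr (u, _), Sum.inr (v, _) => u = v)

/-- `D_{n,q}`: the graph `C_n[q]` together with the edges `{u^[1], v^[1]}` for `{u,v}`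
ranging over the perfect matching `{{2i, 2i+1} : 0 ≤ i < n/2}` of the cycle `C_n`
(`n` even). -/
def Dgraph (n q : ℕ) : SimpleGraph (Fin n ⊕ Fin n × Fin (q + 1)) :=
  extendCliques (SimpleGraph.cycleGraph n) q ⊔
    SimpleGraph.fromRel (fun a b =>
      match a, b with
      | Sum.inr (u, i), Sum.inr (v, j) => i = 0 ∧ j = 0 ∧ u.val / 2 = v.val / 2
      | _, _ => False)

namespace EditHam

variable {V W : Type*}

/-- degree as an `ncard` -/
noncomputable def dg (G : SimpleGraph V) (x : V) : ℕ := (G.neighborSet x).ncard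

lemma sum_dg [Fintype V] (G : SimpleGraph V) : ∑ x, dg G x = 2 * G.edgeSet.ncard := by
  classical
  have h := G.sum_degrees_eq_twice_card_edges
  have h1 : G.edgeSet.ncard = G.edgeFinset.card := by
    rw [← coe_edgeFinset, Set.ncard_coe_finset]
  rw [h1, ← h]
  refine Finset.sum_congr rfl fun x _ => ?_
  rw [dg, Set.ncard_eq_toFinset_card']
  rfl

lemma dg_eq_degree [Fintype V] (G : SimpleGraph V) [DecidableRel G.Adj] (x : V) :
    dg G x = G.degree x := by
  rw [dg, Set.ncard_eq_toFinset_card']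
  rfl

lemma dg_map (G : SimpleGraph V) (π : V ≃ W) (x : V) :
    dg (G.map π.toEmbedding) (π x) = dg G x := by
  have : (G.map π.toEmbedding).neighborSet (π x) = π '' G.neighborSet x := by
    ext y
    simp only [mem_neighborSet, SimpleGraph.map_adj, Set.mem_image]
    constructor
    · rintro ⟨a, b, hab, h1, h2⟩
      have : a = x := π.injective h1
      subst this
      exact ⟨b, hab, h2⟩
    · rintro ⟨b, hb, rfl⟩
      exact ⟨x, b, hb, rfl, rfl⟩
  rw [dg, this, Set.ncard_image_of_injective _ π.injective, dg]

lemma mismatch_adj (G : SimpleGraph V) (H : SimpleGraph W) (π : V ≃ W) (x y : W) :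
    (mismatchGraph G H π).Adj x y ↔
      (G.Adj (π.symm x) (π.symm y) ∧ ¬ H.Adj x y) ∨
      (H.Adj x y ∧ ¬ G.Adj (π.symm x) (π.symm y)) := by
  have h : (G.map π.toEmbedding).Adj x y ↔ G.Adj (π.symm x) (π.symm y) := by
    rw [SimpleGraph.map_adj]
    constructor
    · rintro ⟨a, b, hab, rfl, rfl⟩
      simpa using hab
    · intro h
      exact ⟨_, _, h, by simp, by simp⟩
  rw [mismatchGraph, symmDiff_def, SimpleGraph.sup_adj, SimpleGraph.sdiff_adj,
    SimpleGraph.sdiff_adj, h]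

lemma dg_le_add [Finite V] (A H : SimpleGraph V) (x : V) :
    dg A x ≤ dg H x + dg (symmDiff A H) x := by
  unfold dg
  refine le_trans (Set.ncard_le_ncard ?_ (Set.toFinite _)) (Set.ncard_union_le _ _)
  intro y hy
  by_cases h : H.Adj x y
  · exact Or.inl h
  · right
    simp only [mem_neighborSet, symmDiff_def, SimpleGraph.sup_adj, SimpleGraph.sdiff_adj] at *
    tauto

lemma dg_add_two_le [Finite V] (A H : SimpleGraph V) (x z : V) (hz : H.Adj x z)
    (hz' : ¬ A.Adj x z) :
    dg A x + 2 ≤ dg H x + dg (symmDiff A H) x := by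
  unfold dg
  have h1 : ((H.neighborSet x) \ {z}).ncard + 1 = (H.neighborSet x).ncard :=
    Set.ncard_sdiff_singleton_add_one hz (Set.toFinite _)
  have h2 : (((symmDiff A H).neighborSet x) \ {z}).ncard + 1
      = ((symmDiff A H).neighborSet x).ncard := by
    refine Set.ncard_sdiff_singleton_add_one ?_ (Set.toFinite _)
    simp only [mem_neighborSet, symmDiff_def, SimpleGraph.sup_adj, SimpleGraph.sdiff_adj]
    tauto
  have h3 : (A.neighborSet x).ncard ≤
      ((H.neighborSet x) \ {z}).ncard + (((symmDiff A H).neighborSet x) \ {z}).ncard := by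
    refine le_trans (Set.ncard_le_ncard ?_ (Set.toFinite _)) (Set.ncard_union_le _ _)
    intro y hy
    have hyz : y ≠ z := by
      rintro rfl
      exact hz' hy
    by_cases h : H.Adj x y
    · exact Or.inl ⟨h, hyz⟩
    · right
      refine ⟨?_, hyz⟩
      simp only [mem_neighborSet, symmDiff_def, SimpleGraph.sup_adj, SimpleGraph.sdiff_adj] at *
      tauto
  omega

section ext
variable (G : SimpleGraph V) (q : ℕ)

lemma ext_ll (u v : V) : (extendCliques G q).Adj (Sum.inl u) (Sum.inl v) ↔ G.Adj u v := by
  simp only [extendCliques, fromRel_adj]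
  constructor
  · rintro ⟨-, h | h⟩
    · exact h
    · exact h.symm
  · intro h
    exact ⟨by simpa using h.ne, Or.inl h⟩

lemma ext_lr (u v : V) (i : Fin (q + 1)) :
    (extendCliques G q).Adj (Sum.inl u) (Sum.inr (v, i)) ↔ u = v ∧ i = 0 := by
  simp [extendCliques, fromRel_adj]

lemma ext_rl (u v : V) (i : Fin (q + 1)) :
    (extendCliques G q).Adj (Sum.inr (v, i)) (Sum.inl u) ↔ u = v ∧ i = 0 := by
  simp [extendCliques, fromRel_adj]

lemma ext_rr (u v : V) (i j : Fin (q + 1)) :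
    (extendCliques G q).Adj (Sum.inr (u, i)) (Sum.inr (v, j)) ↔ u = v ∧ i ≠ j := by
  simp only [extendCliques, fromRel_adj]
  constructor
  · rintro ⟨h, h1⟩
    have : u = v := by tauto
    subst this
    exact ⟨rfl, fun h' => h (by rw [h'])⟩
  · rintro ⟨rfl, h⟩
    exact ⟨fun h' => h (by simpa using h'), Or.inl rfl⟩

lemma dg_ext_inl [Finite V] (v : V) : dg (extendCliques G q) (Sum.inl v) = dg G v + 1 := by
  have : (extendCliques G q).neighborSet (Sum.inl v) =
      insert (Sum.inr (v, 0)) (Sum.inl '' G.neighborSet v) := by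
    ext (y | ⟨y, i⟩)
    · simp [ext_ll]
    · simp only [mem_neighborSet, ext_lr]
      simp [eq_comm]
  rw [dg, this, Set.ncard_insert_of_notMem (by simp) (Set.toFinite _),
    Set.ncard_image_of_injective _ Sum.inl_injective, dg]

/-- the clique neighbours -/
def cl (v : V) (i : Fin (q + 1)) : Set (V ⊕ V × Fin (q + 1)) :=
  (fun j => Sum.inr (v, j)) '' {i}ᶜ

lemma cl_card (v : V) (i : Fin (q + 1)) : (cl q v i).ncard = q := by
  rw [cl, Set.ncard_image_of_injective _ (fun a b h => by simpa using h), Set.ncard_compl]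
  simp

lemma mem_cl_inl (v w : V) (i : Fin (q + 1)) : Sum.inl w ∈ cl q v i ↔ False := by
  simp [cl]

lemma mem_cl_inr (v w : V) (i j : Fin (q + 1)) :
    Sum.inr (w, j) ∈ cl q v i ↔ v = w ∧ i ≠ j := by
  simp only [cl, Set.mem_image, Set.mem_compl_iff, Set.mem_singleton_iff, Sum.inr.injEq,
    Prod.mk.injEq]
  constructor
  · rintro ⟨k, hk, rfl, rfl⟩
    exact ⟨rfl, Ne.symm hk⟩
  · rintro ⟨rfl, h⟩
    exact ⟨j, Ne.symm h, rfl, rfl⟩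

lemma dg_ext_zero [Finite V] (v : V) : dg (extendCliques G q) (Sum.inr (v, 0)) = q + 1 := by
  have : (extendCliques G q).neighborSet (Sum.inr (v, 0)) =
      insert (Sum.inl v) (cl q v 0) := by
    ext (y | ⟨y, i⟩)
    · simp [ext_rl, mem_cl_inl]
    · simp [ext_rr, mem_cl_inr]
  rw [dg, this, Set.ncard_insert_of_notMem (by simp [mem_cl_inl]) (Set.toFinite _), cl_card]

end ext

section D
variable (n q : ℕ)

lemma D_ll (u v : Fin n) : (Dgraph n q).Adj (Sum.inl u) (Sum.inl v) ↔ (cycleGraph n).Adj u v := by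
  simp [Dgraph, ext_ll]

lemma D_lr (u v : Fin n) (i : Fin (q + 1)) :
    (Dgraph n q).Adj (Sum.inl u) (Sum.inr (v, i)) ↔ u = v ∧ i = 0 := by
  simp [Dgraph, ext_lr]

lemma D_rl (u v : Fin n) (i : Fin (q + 1)) :
    (Dgraph n q).Adj (Sum.inr (v, i)) (Sum.inl u) ↔ u = v ∧ i = 0 := by
  simp [Dgraph, ext_rl]

lemma D_rr (u v : Fin n) (i j : Fin (q + 1)) :
    (Dgraph n q).Adj (Sum.inr (u, i)) (Sum.inr (v, j)) ↔
      (u = v ∧ i ≠ j) ∨ (i = 0 ∧ j = 0 ∧ u ≠ v ∧ u.val / 2 = v.val / 2) := by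
  simp only [Dgraph, sup_adj, ext_rr, fromRel_adj]
  constructor
  · rintro (h | ⟨h, h'⟩)
    · exact Or.inl h
    · right
      have : i = 0 ∧ j = 0 ∧ u.val / 2 = v.val / 2 := by
        rcases h' with h' | h'
        · exact h'
        · exact ⟨h'.2.1, h'.1, h'.2.2.symm⟩
      obtain ⟨rfl, rfl, h2⟩ := this
      exact ⟨rfl, rfl, fun h3 => h (by rw [h3]), h2⟩
  · rintro (h | ⟨rfl, rfl, h, h2⟩)
    · exact Or.inl h
    · exact Or.inr ⟨fun h3 => h (by simpa using h3), Or.inl ⟨rfl, rfl, h2⟩⟩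

lemma partner (hE : Even n) (u : Fin n) :
    ∃ w : Fin n, ∀ v : Fin n, (u ≠ v ∧ u.val / 2 = v.val / 2) ↔ v = w := by
  obtain ⟨k, hk⟩ := hE
  have hu := u.2
  by_cases h : u.val % 2 = 0
  · refine ⟨⟨u.val + 1, by omega⟩, fun v => ?_⟩
    simp only [ne_eq, Fin.ext_iff]
    omega
  · refine ⟨⟨u.val - 1, by omega⟩, fun v => ?_⟩
    simp only [ne_eq, Fin.ext_iff]
    omega

lemma dg_cycle (hn : 4 ≤ n) (u : Fin n) : dg (cycleGraph n) u = 2 := by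
  obtain ⟨m, rfl⟩ : ∃ m, n = m + 3 := ⟨n - 3, by omega⟩
  rw [dg_eq_degree, cycleGraph_degree_three_le]

lemma dg_D_inl (hn : 4 ≤ n) (v : Fin n) : dg (Dgraph n q) (Sum.inl v) = 3 := by
  have : (Dgraph n q).neighborSet (Sum.inl v) =
      insert (Sum.inr (v, 0)) (Sum.inl '' (cycleGraph n).neighborSet v) := by
    ext (y | ⟨y, i⟩)
    · simp [D_ll]
    · simp only [mem_neighborSet, D_lr]
      simp [eq_comm]
  rw [dg, this, Set.ncard_insert_of_notMem (by simp) (Set.toFinite _),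
    Set.ncard_image_of_injective _ Sum.inl_injective]
  have := dg_cycle n hn v
  rw [dg] at this
  omega

lemma dg_D_inr (hE : Even n) (v : Fin n) (i : Fin (q + 1)) :
    dg (Dgraph n q) (Sum.inr (v, i)) = q ∨ dg (Dgraph n q) (Sum.inr (v, i)) = q + 2 := by
  by_cases hi : i = 0
  · right
    subst hi
    obtain ⟨w, hw⟩ := partner n hE v
    have hvw : v ≠ w := ((hw w).2 rfl).1
    have : (Dgraph n q).neighborSet (Sum.inr (v, 0)) =
        insert (Sum.inl v) (insert (Sum.inr (w, 0)) (cl q v 0)) := by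
      ext (y | ⟨y, i⟩)
      · simp [D_rl, mem_cl_inl]
      · have := hw y
        simp only [mem_neighborSet, D_rr, Set.mem_insert_iff, mem_cl_inr, Sum.inr.injEq,
          Prod.mk.injEq, reduceCtorEq, false_or]
        tauto
    rw [dg, this, Set.ncard_insert_of_notMem (by simp [mem_cl_inl]) (Set.toFinite _),
      Set.ncard_insert_of_notMem (by simp [mem_cl_inr]) (Set.toFinite _), cl_card]
  · left
    have : (Dgraph n q).neighborSet (Sum.inr (v, i)) = cl q v i := by
      ext (y | ⟨y, j⟩)
      · simp [D_rl, mem_cl_inl, hi]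
      · simp [D_rr, mem_cl_inr, hi]
    rw [dg, this, cl_card]

end D

lemma ham_iff [Fintype V] [DecidableEq V] (n : ℕ) (hn : 4 ≤ n) (G : SimpleGraph V)
    (hcard : Fintype.card V = n) : G.IsHamiltonian ↔ cycleGraph n ⊑ G := by
  rw [cycleGraph_isContained_iff (by omega), SimpleGraph.IsHamiltonian]
  simp only [Walk.isHamiltonianCycle_iff_isCycle_and_length_eq, hcard]
  constructor
  · intro h
    exact h (by omega)
  · intro h _
    exact h

lemma upper [Fintype V] (n q : ℕ) (hE : Even n) (hn : 4 ≤ n) (G : SimpleGraph V)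
    (hcard : Fintype.card V = n) (hreg : ∀ v, dg G v = 3) (h : cycleGraph n ⊑ G) :
    ∃ π, muEdit (extendCliques G q) (Dgraph n q) π ≤ n := by
  obtain ⟨f⟩ := h
  have hb : Function.Bijective f := by
    rw [Fintype.bijective_iff_injective_and_card]
    exact ⟨f.injective, by simp [hcard]⟩
  let e : V ≃ Fin n := (Equiv.ofBijective f hb).symm
  have he : ∀ x y, (cycleGraph n).Adj x y → G.Adj (e.symm x) (e.symm y) :=
    fun x y hxy => f.toHom.map_adj hxy
  let π : V ⊕ V × Fin (q + 1) ≃ Fin n ⊕ Fin n × Fin (q + 1) :=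
    Equiv.sumCongr e (Equiv.prodCongr e (Equiv.refl _))
  have πl : ∀ x, π.symm (Sum.inl x) = Sum.inl (e.symm x) := fun x => rfl
  have πr : ∀ x i, π.symm (Sum.inr (x, i)) = Sum.inr (e.symm x, i) := fun x i => rfl
  refine ⟨π, ?_⟩
  set M := mismatchGraph (extendCliques G q) (Dgraph n q) π with hM
  have hs := sum_dg M
  have h1 : ∀ x, dg M (Sum.inl x) ≤ 1 := by
    intro x
    have hN : M.neighborSet (Sum.inl x) =
        Sum.inl '' ((e '' G.neighborSet (e.symm x)) \ (cycleGraph n).neighborSet x) := by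
      ext (y | ⟨y, j⟩)
      · have := he x y
        simp only [mem_neighborSet, hM, mismatch_adj, πl, ext_ll, D_ll, Set.mem_image,
          Set.mem_sdiff, Sum.inl.injEq, exists_eq_right, ← e.eq_symm_apply]
        tauto
      · simp [hM, mismatch_adj, πl, πr, ext_lr, D_lr]
    rw [dg, hN, Set.ncard_image_of_injective _ Sum.inl_injective, Set.ncard_sdiff _ (Set.toFinite _),
      Set.ncard_image_of_injective _ e.injective]
    · have a1 := hreg (e.symm x)
      have a2 := dg_cycle n hn x
      rw [dg] at a1 a2
      omega
    · intro y hy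
      exact ⟨e.symm y, he x y hy, by simp⟩
  have h2 : ∀ x i, dg M (Sum.inr (x, i)) ≤ if i = 0 then 1 else 0 := by
    intro x i
    split_ifs with hi
    · subst hi
      obtain ⟨w, hw⟩ := partner n hE x
      have : M.neighborSet (Sum.inr (x, 0)) ⊆ {Sum.inr (w, 0)} := by
        rintro (y | ⟨y, j⟩)
        · simp [hM, mismatch_adj, πl, πr, ext_rl, D_rl]
        · have := hw y
          simp only [mem_neighborSet, hM, mismatch_adj, πr, ext_rr, D_rr, Set.mem_singleton_iff,
            Sum.inr.injEq, Prod.mk.injEq, e.symm.injective.eq_iff]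
          tauto
      have := Set.ncard_le_ncard this (Set.toFinite _)
      rwa [Set.ncard_singleton] at this
    · have : M.neighborSet (Sum.inr (x, i)) = ∅ := by
        ext (y | ⟨y, j⟩)
        · simp [hM, mismatch_adj, πl, πr, ext_rl, D_rl]
        · simp [hM, mismatch_adj, πr, ext_rr, D_rr, hi]
      rw [dg, this, Set.ncard_empty]
  rw [Fintype.sum_sum_type, Fintype.sum_prod_type] at hs
  have s1 : ∑ x, dg M (Sum.inl x) ≤ n := by
    refine (Finset.sum_le_sum fun x _ => h1 x).trans ?_
    simp
  have s2 : ∑ x, ∑ i, dg M (Sum.inr (x, i)) ≤ n := by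
    refine (Finset.sum_le_sum fun x _ => Finset.sum_le_sum fun i _ => h2 x i).trans ?_
    simp
  change M.edgeSet.ncard ≤ n
  omega

lemma lower [Fintype V] (n q : ℕ) (hE : Even n) (hn : 4 ≤ n) (hq : 3 * n + 4 ≤ q)
    (G : SimpleGraph V)
    (hcard : Fintype.card V = n) (hreg : ∀ v, dg G v = 3)
    (π : V ⊕ V × Fin (q + 1) ≃ Fin n ⊕ Fin n × Fin (q + 1))
    (hπ : muEdit (extendCliques G q) (Dgraph n q) π ≤ n) : cycleGraph n ⊑ G := by
  set A := (extendCliques G q).map π.toEmbedding with hA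
  set H := Dgraph n q with hH
  set M := symmDiff A H with hM
  have hsum : ∑ x, dg M x ≤ 2 * n := by
    rw [sum_dg]
    exact Nat.mul_le_mul_left 2 hπ
  have hMle : ∀ x, dg M x ≤ 2 * n := fun x =>
    (Finset.single_le_sum (fun _ _ => Nat.zero_le _) (Finset.mem_univ x)).trans hsum
  have hAl : ∀ v, dg A (π (Sum.inl v)) = 4 := fun v => by
    rw [hA, dg_map, dg_ext_inl, hreg]
  have hAr : ∀ v, dg A (π (Sum.inr (v, 0))) = q + 1 := fun v => by
    rw [hA, dg_map, dg_ext_zero]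
  have hHA : ∀ x, dg H x ≤ dg A x + dg M x := fun x => by
    rw [hM, symmDiff_comm]
    exact dg_le_add H A x
  have hAH : ∀ x, dg A x ≤ dg H x + dg M x := fun x => dg_le_add A H x
  have hbase : ∀ v, ∃ w, π (Sum.inl v) = Sum.inl w := by
    intro v
    rcases hx : π (Sum.inl v) with w | ⟨w, i⟩
    · exact ⟨w, rfl⟩
    · exfalso
      have a1 := hHA (π (Sum.inl v))
      have a2 := hMle (π (Sum.inl v))
      have a3 := hAl v
      have a4 := dg_D_inr n q hE w i
      rw [hx] at a1 a2 a3
      rw [← hH] at a4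
      omega
  choose f hf using hbase
  have hfi : Function.Injective f := by
    intro a b hab
    have : π (Sum.inl a) = π (Sum.inl b) := by rw [hf, hf, hab]
    simpa using this
  have hfb : Function.Bijective f := by
    rw [Fintype.bijective_iff_injective_and_card]
    exact ⟨hfi, by simp [hcard]⟩
  have hl1 : ∀ v, 1 ≤ dg M (π (Sum.inl v)) := by
    intro v
    have a1 := hAH (π (Sum.inl v))
    have a3 := hAl v
    have a4 := dg_D_inl n q hn (f v)
    rw [← hf, ← hH] at a4
    omega
  have hr1 : ∀ v, 1 ≤ dg M (π (Sum.inr (v, 0))) := by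
    intro v
    have a1 := hAH (π (Sum.inr (v, 0)))
    have a2 := hHA (π (Sum.inr (v, 0)))
    have a3 := hAr v
    rcases hx : π (Sum.inr (v, 0)) with w | ⟨w, i⟩
    · obtain ⟨u, rfl⟩ := hfb.2 w
      rw [← hf] at hx
      simp at hx
    · have a4 := dg_D_inr n q hE w i
      rw [hx] at a1 a2 a3
      rw [← hH] at a4
      omega
  have hsum2 : ∑ v, dg M (π (Sum.inl v)) ≤ n := by
    rw [← Equiv.sum_comp π, Fintype.sum_sum_type, Fintype.sum_prod_type] at hsum
    have : n ≤ ∑ v, ∑ i, dg M (π (Sum.inr (v, i))) := by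
      calc n = ∑ v : V, 1 := by simp [hcard]
        _ ≤ _ := Finset.sum_le_sum fun v _ => (hr1 v).trans
          (Finset.single_le_sum (f := fun i => dg M (π (Sum.inr (v, i))))
            (fun _ _ => Nat.zero_le _) (Finset.mem_univ 0))
    omega
  have hl2 : ∀ v, dg M (π (Sum.inl v)) ≤ 1 := by
    intro v
    by_contra hc
    have : ∑ v : V, 1 < ∑ v, dg M (π (Sum.inl v)) :=
      Finset.sum_lt_sum (fun v _ => hl1 v) ⟨v, Finset.mem_univ _, by omega⟩
    simp [hcard] at this
    omega
  have key : ∀ u v, (cycleGraph n).Adj (f u) (f v) → G.Adj u v := by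
    intro u v huv
    by_contra hG
    have b1 : H.Adj (π (Sum.inl u)) (π (Sum.inl v)) := by
      rw [hf, hf, hH, D_ll]
      exact huv
    have b2 : ¬ A.Adj (π (Sum.inl u)) (π (Sum.inl v)) := by
      rw [hA, SimpleGraph.map_adj]
      rintro ⟨a, b, hab, h1, h2⟩
      have h1 := π.injective h1
      have h2 := π.injective h2
      subst h1 h2
      exact hG ((ext_ll G q u v).1 hab)
    have b3 := dg_add_two_le A H _ _ b1 b2
    have a3 := hAl u
    have a4 := dg_D_inl n q hn (f u)
    have a5 := hl2 u
    rw [← hf, ← hH] at a4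
    rw [← hM] at b3
    omega
  let e := Equiv.ofBijective f hfb
  refine ⟨⟨⟨e.symm, ?_⟩, e.symm.injective⟩⟩
  intro x y hxy
  apply key
  have : ∀ z, f (e.symm z) = z := fun z => e.apply_symm_apply z
  rwa [this, this]

end EditHam

/-- Let `G` be a 3-regular graph on `n` vertices (`n` even, `n ≥ 4`) and
let `q ≥ 3n + 4` be any natural number. Then `δ_edit(G[q], D_{n,q}) ≤ n` if and only if
`G` has a Hamiltonian cycle. -/
theorem statement_5 {V : Type*} [Fintype V] [DecidableEq V] (n : ℕ) (hEven : Even n)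
    (hn : 4 ≤ n) (G : SimpleGraph V) [DecidableRel G.Adj] (hcard : Fintype.card V = n)
    (hreg : G.IsRegularOfDegree 3) (q : ℕ) (hq : 3 * n + 4 ≤ q) :
    deltaEdit (extendCliques G q) (Dgraph n q) ≤ n ↔ G.IsHamiltonian := by
  have hd : ∀ v, EditHam.dg G v = 3 := fun v => by
    rw [EditHam.dg_eq_degree]
    exact hreg v
  rw [EditHam.ham_iff n hn G hcard]
  constructor
  · intro h
    have : Nonempty (V ⊕ V × Fin (q + 1) ≃ Fin n ⊕ Fin n × Fin (q + 1)) := by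
      let e : V ≃ Fin n := Fintype.equivFinOfCardEq hcard
      exact ⟨Equiv.sumCongr e (Equiv.prodCongr e (Equiv.refl _))⟩
    obtain ⟨π, hπ⟩ := ciInf_mem (fun π => muEdit (extendCliques G q) (Dgraph n q) π)
    refine EditHam.lower n q hEven hn hq G hcard hd π ?_
    exact hπ.le.trans h
  · intro h
    obtain ⟨π, hπ⟩ := EditHam.upper n q hEven hn G hcard hd h
    exact (ciInf_le (OrderBot.bddBelow _) π).trans hπ
end

section
/- Let k ≥ 2, let G_k be a 3-regular bipartite graph on 2k vertices with bipartition into independent sets A and B of size k, and let H_k be as constructed. For σ ∈ Res(G_k, H_k), let A(σ) be the signed adjacency matrix of the mismatch graph G_k^σ − H_k (entries +1 on positive edges, −1 on negative edges, 0 otherwise). The following are equivalent: (1) G_k has a Hamiltonian cycle; (2) there exists σ ∈ Res(G_k, H_k) with ‖abs(A(σ))‖₂ ≤ 2, where abs denotes the entrywise absolute value; (3) there exists σ ∈ Res(G_k, H_k) with ‖A(σ)‖₂ ≤ 2. Here ‖·‖₂ is the spectral (ℓ_2-operator) norm. -/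
open SimpleGraph

/-- The graph `H_k` on vertex set `{0, 1, …, 2k−1}`: the Hamiltonian cycle
`0 − 1 − ⋯ − (2k−1) − 0` together with, for even `k`, the chords `{i, i+2}` for
`i ≡ 0, 1 (mod 4)`, and for odd `k`, the chords `{i, i−2}` for `i ≡ 2 (mod 4)`,
`{i, i+2}` for `i ≡ 3 (mod 4)`, and `{2k−2, 1}`. -/
def Hk (k : ℕ) : SimpleGraph (Fin (2 * k)) :=
  SimpleGraph.fromRel (fun a b =>
    (b.val = a.val + 1) ∨ (a.val = 2 * k - 1 ∧ b.val = 0) ∨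
    (if k % 2 = 0 then
      (a.val % 4 = 0 ∨ a.val % 4 = 1) ∧ b.val = a.val + 2
    else
      (a.val % 4 = 2 ∧ b.val = a.val - 2) ∨ (a.val % 4 = 3 ∧ b.val = a.val + 2) ∨
        (a.val = 2 * k - 2 ∧ b.val = 1)))

/-- Attach `5` new pendant leaves to every vertex satisfying `P` and `12` new pendant
leaves to every other vertex. The leaves of `v` are `Sum.inr ⟨v, i⟩`. -/
def hatGraph {V : Type*} (G : SimpleGraph V) (P : V → Prop) [DecidablePred P] :
    SimpleGraph (V ⊕ Σ v : V, Fin (if P v then 5 else 12)) :=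
  SimpleGraph.fromRel (fun a b =>
    match a, b with
    | Sum.inl u, Sum.inl v => G.Adj u v
    | Sum.inl u, Sum.inr x => u = x.1
    | _, _ => False)

/-- `σ ∈ Res(G_k, H_k)`: the bijection `σ` maps the independent set `A` onto the even
vertices `Even(2k)` (and hence its complement `B` onto the odd vertices `Odd(2k)`). -/
def InRes {V : Type*} (k : ℕ) (A : Finset V) (σ : V ≃ Fin (2 * k)) : Prop :=
  ∀ v, v ∈ A ↔ (σ v).val % 2 = 0

section Helpers

lemma aux_lpNorm_two {W : Type*} [Fintype W] (x : W → ℝ) :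
    lpNorm 2 x = Real.sqrt (∑ i, x i ^ 2) := by
  unfold lpNorm
  rw [Real.sqrt_eq_rpow]
  norm_num

lemma aux_ratio_le_iff {W : Type*} [Fintype W] (M : Matrix W W ℝ) (c : ℝ) (hc : 0 ≤ c)
    (x : W → ℝ) (hx : x ≠ 0) :
    lpNorm 2 (M.mulVec x) / lpNorm 2 x ≤ c ↔
      ∑ i, (M.mulVec x) i ^ 2 ≤ c ^ 2 * ∑ i, x i ^ 2 := by
  have hpos : 0 < ∑ i, x i ^ 2 := by
    obtain ⟨i, hi⟩ := Function.ne_iff.1 hx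
    have h1 : 0 < x i ^ 2 := by
      have : x i ≠ 0 := hi
      positivity
    exact lt_of_lt_of_le h1
      (Finset.single_le_sum (f := fun i => x i ^ 2) (fun j _ => sq_nonneg _) (Finset.mem_univ i))
  rw [aux_lpNorm_two, aux_lpNorm_two, div_le_iff₀ (Real.sqrt_pos.2 hpos),
    Real.sqrt_le_left (by positivity), mul_pow, Real.sq_sqrt hpos.le]

lemma aux_lpOpNorm_le {W : Type*} [Fintype W] (M : Matrix W W ℝ)
    (h : ∀ x : W → ℝ, ∑ i, (M.mulVec x) i ^ 2 ≤ 2 ^ 2 * ∑ i, x i ^ 2) :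
    lpOpNorm 2 M ≤ 2 := by
  unfold lpOpNorm
  refine Real.iSup_le (fun x => ?_) (by norm_num)
  exact (aux_ratio_le_iff M 2 (by norm_num) x.1 x.2).2 (h _)

lemma aux_of_lpOpNorm_le {W : Type*} [Fintype W] (M : Matrix W W ℝ) (h : lpOpNorm 2 M ≤ 2)
    (x : W → ℝ) : ∑ i, (M.mulVec x) i ^ 2 ≤ 2 ^ 2 * ∑ i, x i ^ 2 := by
  by_cases hx : x = 0
  · subst hx; simp
  refine (aux_ratio_le_iff M 2 (by norm_num) x hx).1 (le_trans ?_ h)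
  unfold lpOpNorm
  refine le_ciSup (f := fun x : {x : W → ℝ // x ≠ 0} =>
    lpNorm 2 (M.mulVec x.1) / lpNorm 2 x.1) ?_ ⟨x, hx⟩
  refine ⟨Real.sqrt (∑ i, ∑ j, M i j ^ 2), ?_⟩
  rintro _ ⟨y, rfl⟩
  refine (aux_ratio_le_iff M _ (Real.sqrt_nonneg _) y.1 y.2).2 ?_
  have hF : (0 : ℝ) ≤ ∑ i, ∑ j, M i j ^ 2 :=
    Finset.sum_nonneg fun i _ => Finset.sum_nonneg fun j _ => sq_nonneg _
  rw [Real.sq_sqrt hF, Finset.sum_mul]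
  refine Finset.sum_le_sum fun i _ => ?_
  exact Finset.sum_mul_sq_le_sq_mul_sq _ _ _

/-- Row-sum bound for a symmetric matrix. -/
lemma aux_lpOpNorm_le_of_rows {W : Type*} [Fintype W] (M : Matrix W W ℝ)
    (hs : ∀ i j, M i j = M j i) (hr : ∀ i, ∑ j, |M i j| ≤ 2) : lpOpNorm 2 M ≤ 2 := by
  apply aux_lpOpNorm_le
  intro x
  have h1 : ∀ i, (M.mulVec x) i ^ 2 ≤ 2 * ∑ j, |M i j| * x j ^ 2 := by
    intro i
    have h2 : (∑ j, M i j * x j) ^ 2 ≤ (∑ j, |M i j|) * ∑ j, |M i j| * x j ^ 2 := by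
      apply Finset.sum_sq_le_sum_mul_sum_of_sq_le_mul
      · intro j _; positivity
      · intro j _; positivity
      · intro j _
        rw [← mul_assoc, abs_mul_abs_self]
        exact le_of_eq (by ring)
    refine le_trans h2 (mul_le_mul_of_nonneg_right (hr i) ?_)
    exact Finset.sum_nonneg fun j _ => by positivity
  calc ∑ i, (M.mulVec x) i ^ 2 ≤ ∑ i, 2 * ∑ j, |M i j| * x j ^ 2 :=
        Finset.sum_le_sum fun i _ => h1 i
    _ = 2 * ∑ j, (∑ i, |M j i|) * x j ^ 2 := by
        rw [← Finset.mul_sum, Finset.sum_comm]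
        congr 1
        refine Finset.sum_congr rfl fun j _ => ?_
        rw [Finset.sum_mul]
        exact Finset.sum_congr rfl fun i _ => by rw [hs i j]
    _ ≤ 2 * ∑ j, 2 * x j ^ 2 := by
        gcongr with j _
        exact hr j
    _ = 2 ^ 2 * ∑ i, x i ^ 2 := by rw [← Finset.mul_sum]; ring

/-- The norm of the absolute value matrix dominates the norm. -/
lemma aux_lpOpNorm_of_abs {W : Type*} [Fintype W] (M : Matrix W W ℝ)
    (h : lpOpNorm 2 (M.map abs) ≤ 2) : lpOpNorm 2 M ≤ 2 := by
  apply aux_lpOpNorm_le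
  intro x
  have h1 := aux_of_lpOpNorm_le _ h (fun i => |x i|)
  simp only [sq_abs] at h1
  refine le_trans (Finset.sum_le_sum fun i _ => ?_) h1
  rw [sq_le_sq]
  refine le_trans ?_ (le_abs_self _)
  simp only [Matrix.mulVec, dotProduct, Matrix.map_apply, ← abs_mul]
  exact Finset.abs_sum_le_sum_abs _ _

/-- If `M` is symmetric with zero row sums and norm at most 2, each row has square sum `< 4`. -/
lemma aux_row_lt {W : Type*} [Fintype W] (M : Matrix W W ℝ)
    (hs : ∀ i j, M i j = M j i) (hr : ∀ i, ∑ j, M i j = 0) (h : lpOpNorm 2 M ≤ 2) (x : W) :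
    ∑ j, M x j ^ 2 < 4 := by
  classical
  have hN : (0 : ℝ) < Fintype.card W := by
    have : Nonempty W := ⟨x⟩
    exact_mod_cast Fintype.card_pos
  set c : ℝ := (Fintype.card W : ℝ)⁻¹ with hc
  have hc0 : 0 < c := inv_pos.2 hN
  have h1 := aux_of_lpOpNorm_le _ h (fun i => (if i = x then 1 else 0) - c)
  have h2 : ∀ i, (M.mulVec (fun i => (if i = x then 1 else 0) - c)) i = M x i := by
    intro i
    simp [Matrix.mulVec, dotProduct, mul_sub, Finset.sum_sub_distrib, ← Finset.sum_mul, hr i, hs]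
  have h3 : ∑ i : W, ((if i = x then (1 : ℝ) else 0) - c) ^ 2 = 1 - c := by
    have : ∀ i : W, ((if i = x then (1 : ℝ) else 0) - c) ^ 2
        = (if i = x then 1 - 2 * c else 0) + c ^ 2 := by
      intro i; split_ifs <;> ring
    simp only [this, Finset.sum_add_distrib]
    simp
    rw [hc]; field_simp; ring
  simp only [h2, h3] at h1
  linarith

/-! ### The graph `Hk` -/

def auxSuc (k i : ℕ) : ℕ := if i = 2 * k - 1 then 0 else i + 1

def auxPre (k i : ℕ) : ℕ := if i = 0 then 2 * k - 1 else i - 1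

def auxCh (k i : ℕ) : ℕ :=
  if k % 2 = 0 then (if i % 4 = 0 ∨ i % 4 = 1 then i + 2 else i - 2)
  else if i = 1 then 2 * k - 2 else if i = 2 * k - 2 then 1
  else if i % 4 = 0 ∨ i % 4 = 3 then i + 2 else i - 2

lemma aux_lt (k i : ℕ) (hk : 2 ≤ k) (hi : i < 2 * k) :
    auxSuc k i < 2 * k ∧ auxPre k i < 2 * k ∧ auxCh k i < 2 * k := by
  unfold auxSuc auxPre auxCh
  refine ⟨?_, ?_, ?_⟩ <;> split_ifs <;> omega

lemma aux_distinct (k i : ℕ) (hk : 2 ≤ k) (hi : i < 2 * k) :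
    auxSuc k i ≠ auxPre k i ∧ auxSuc k i ≠ auxCh k i ∧ auxPre k i ≠ auxCh k i := by
  unfold auxSuc auxPre auxCh
  refine ⟨?_, ?_, ?_⟩ <;> split_ifs <;> omega

lemma aux_parity (k i : ℕ) (hk : 2 ≤ k) (hi : i < 2 * k) :
    auxCh k i % 2 = i % 2 ∨ auxCh k (auxSuc k i) % 2 = auxSuc k i % 2 := by
  unfold auxSuc auxCh
  split_ifs <;> omega

lemma aux_pre_suc (k i j : ℕ) (hk : 2 ≤ k) (hi : i < 2 * k) (hj : j < 2 * k) :
    j = auxPre k i ↔ i = auxSuc k j := by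
  unfold auxSuc auxPre
  split_ifs <;> omega

lemma aux_Hk_adj (k : ℕ) (hk : 2 ≤ k) (a b : Fin (2 * k)) :
    (Hk k).Adj a b ↔ b.val = auxSuc k a ∨ b.val = auxPre k a ∨ b.val = auxCh k a := by
  have ha := a.2
  have hb := b.2
  unfold Hk
  rw [SimpleGraph.fromRel_adj]
  simp only [ne_eq, Fin.ext_iff]
  generalize a.val = i at *
  generalize b.val = j at *
  rcases Nat.mod_two_eq_zero_or_one k with h | h
  · simp only [auxCh, h, if_true]
    constructor
    · rintro ⟨hne, (h1 | h1 | ⟨h1, h2⟩) | (h1 | h1 | ⟨h1, h2⟩)⟩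
      · left; unfold auxSuc; split_ifs <;> omega
      · left; unfold auxSuc; split_ifs <;> omega
      · right; right; split_ifs; omega
      · right; left; unfold auxPre; split_ifs <;> omega
      · right; left; unfold auxPre; split_ifs <;> omega
      · right; right; split_ifs <;> omega
    · rintro (h1 | h1 | h1)
      · unfold auxSuc at h1
        split_ifs at h1
        · exact ⟨by omega, Or.inl (Or.inr (Or.inl (by omega)))⟩
        · exact ⟨by omega, Or.inl (Or.inl (by omega))⟩
      · unfold auxPre at h1
        split_ifs at h1
        · exact ⟨by omega, Or.inr (Or.inr (Or.inl (by omega)))⟩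
        · exact ⟨by omega, Or.inr (Or.inl (by omega))⟩
      · split_ifs at h1
        · exact ⟨by omega, Or.inl (Or.inr (Or.inr (by omega)))⟩
        · exact ⟨by omega, Or.inr (Or.inr (Or.inr (by omega)))⟩
  · simp only [auxCh, h, if_false, one_ne_zero]
    constructor
    · rintro ⟨hne, (h1 | h1 | h1 | h1 | h1) | (h1 | h1 | h1 | h1 | h1)⟩
      · left; unfold auxSuc; split_ifs <;> omega
      · left; unfold auxSuc; split_ifs <;> omega
      · right; right; split_ifs <;> omega
      · right; right; split_ifs <;> omega
      · right; right; split_ifs <;> omega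
      · right; left; unfold auxPre; split_ifs <;> omega
      · right; left; unfold auxPre; split_ifs <;> omega
      · right; right; split_ifs <;> omega
      · right; right; split_ifs <;> omega
      · right; right; split_ifs <;> omega
    · rintro (h1 | h1 | h1)
      · unfold auxSuc at h1
        split_ifs at h1
        · exact ⟨by omega, Or.inl (Or.inr (Or.inl (by omega)))⟩
        · exact ⟨by omega, Or.inl (Or.inl (by omega))⟩
      · unfold auxPre at h1
        split_ifs at h1
        · exact ⟨by omega, Or.inr (Or.inr (Or.inl (by omega)))⟩
        · exact ⟨by omega, Or.inr (Or.inl (by omega))⟩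
      · split_ifs at h1 with c1 c2 c3
        · exact ⟨by omega, Or.inr (Or.inr (Or.inr (Or.inr (Or.inr (by omega)))))⟩
        · exact ⟨by omega, Or.inl (Or.inr (Or.inr (Or.inr (Or.inr (by omega)))))⟩
        · refine ⟨by omega, ?_⟩
          rcases c3 with c3 | c3
          · exact Or.inr (Or.inr (Or.inr (Or.inl (by omega))))
          · exact Or.inl (Or.inr (Or.inr (Or.inr (Or.inl (by omega)))))
        · refine ⟨by omega, ?_⟩
          rcases (show i % 4 = 2 ∨ i % 4 = 1 by omega) with c4 | c4
          · exact Or.inl (Or.inr (Or.inr (Or.inl (by omega))))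
          · exact Or.inr (Or.inr (Or.inr (Or.inr (Or.inl (by omega)))))

open Classical in
lemma aux_Hk_row (k : ℕ) (hk : 2 ≤ k) (a b : Fin (2 * k)) :
    (if (Hk k).Adj a b then (1 : ℝ) else 0) =
      (if b = ⟨auxSuc k a, (aux_lt k a hk a.2).1⟩ then 1 else 0)
      + (if b = ⟨auxPre k a, (aux_lt k a hk a.2).2.1⟩ then 1 else 0)
      + (if b = ⟨auxCh k a, (aux_lt k a hk a.2).2.2⟩ then 1 else 0) := by
  simp only [aux_Hk_adj k hk, Fin.ext_iff]
  have := aux_distinct k a hk a.2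
  split_ifs <;> first | omega | norm_num

open Classical in
lemma aux_signedAdj {V W : Type*} (G : SimpleGraph V) (H : SimpleGraph W) (π : V ≃ W) (x y : W) :
    signedAdj G H π x y = (if G.Adj (π.symm x) (π.symm y) then 1 else 0)
      - (if H.Adj x y then 1 else 0) := by
  have h : (G.map π.toEmbedding).Adj x y ↔ G.Adj (π.symm x) (π.symm y) := by
    rw [SimpleGraph.map_adj]
    constructor
    · rintro ⟨u, v, huv, rfl, rfl⟩
      simpa using huv
    · intro h
      exact ⟨_, _, h, by simp, by simp⟩
  unfold signedAdj
  simp only [h]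
  split_ifs <;> simp_all

lemma aux_signedAdj_symm {V W : Type*} (G : SimpleGraph V) (H : SimpleGraph W) (π : V ≃ W)
    (x y : W) : signedAdj G H π x y = signedAdj G H π y x := by
  classical
  rw [aux_signedAdj, aux_signedAdj, G.adj_comm, H.adj_comm]

lemma aux_G_row {V W : Type*} [Fintype V] [Fintype W] (G : SimpleGraph V) [DecidableRel G.Adj]
    (hreg : G.IsRegularOfDegree 3) (π : V ≃ W) (x : W) :
    ∑ y, @ite ℝ (G.Adj (π.symm x) (π.symm y)) (Classical.propDecidable _) 1 0 = 3 := by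
  have hE : ∀ y, @ite ℝ (G.Adj (π.symm x) (π.symm y)) (Classical.propDecidable _) 1 0 =
      (if G.Adj (π.symm x) (π.symm y) then (1 : ℝ) else 0) := by
    intro y
    congr
  simp only [hE]
  rw [Equiv.sum_comp π.symm (fun v => if G.Adj (π.symm x) v then (1 : ℝ) else 0)]
  rw [Finset.sum_boole, ← SimpleGraph.neighborFinset_eq_filter]
  have h := hreg (π.symm x)
  rw [← SimpleGraph.card_neighborFinset_eq_degree] at h
  norm_cast

/-- From the norm bound to Hamiltonicity of the image cycle. -/
lemma aux_cycle_of_norm {V : Type*} [Fintype V] (k : ℕ) (hk : 2 ≤ k)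
    (G : SimpleGraph V) [DecidableRel G.Adj] (hreg : G.IsRegularOfDegree 3)
    (σ : V ≃ Fin (2 * k))
    (hpar : ∀ x y : Fin (2 * k), x.val % 2 = y.val % 2 → ¬ G.Adj (σ.symm x) (σ.symm y))
    (hn : lpOpNorm 2 (signedAdj G (Hk k) σ) ≤ 2) (x y : Fin (2 * k))
    (hxy : y.val = auxSuc k x) : G.Adj (σ.symm x) (σ.symm y) := by
  classical
  have hrow : ∀ i, ∑ j, signedAdj G (Hk k) σ i j = 0 := by
    intro i
    simp only [aux_signedAdj, Finset.sum_sub_distrib, aux_G_row G hreg, aux_Hk_row k hk,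
      Finset.sum_add_distrib]
    simp
    norm_num
  have key : ∀ x a b : Fin (2 * k), a ≠ b → (Hk k).Adj x a → (Hk k).Adj x b →
      ¬ G.Adj (σ.symm x) (σ.symm a) → G.Adj (σ.symm x) (σ.symm b) := by
    intro x a b hab ha hb hna
    by_contra hnb
    have h1 := aux_row_lt _ (aux_signedAdj_symm G (Hk k) σ) hrow hn x
    have h2 : ∑ j, (signedAdj G (Hk k) σ x j ^ 2 - signedAdj G (Hk k) σ x j) < 4 := by
      rw [Finset.sum_sub_distrib, hrow x]
      linarith
    clear h1
    have h3 : ∑ j ∈ {a, b}, (signedAdj G (Hk k) σ x j ^ 2 - signedAdj G (Hk k) σ x j) ≤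
        ∑ j, (signedAdj G (Hk k) σ x j ^ 2 - signedAdj G (Hk k) σ x j) := by
      apply Finset.sum_le_sum_of_subset_of_nonneg (Finset.subset_univ _)
      intro j _ _
      rw [aux_signedAdj]
      split_ifs <;> norm_num
    rw [Finset.sum_pair hab, aux_signedAdj, aux_signedAdj] at h3
    simp only [ha, hb, hna, hnb, if_true, if_false] at h3
    have h4 := lt_of_le_of_lt h3 h2
    norm_num at h4
  have dx := aux_distinct k x hk x.2
  have dy := aux_distinct k y hk y.2
  rcases aux_parity k x hk x.2 with h | h
  · refine key x ⟨auxCh k x, (aux_lt k x hk x.2).2.2⟩ y ?_ ?_ ?_ ?_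
    · simp only [ne_eq, Fin.ext_iff]; omega
    · rw [aux_Hk_adj k hk]; simp
    · rw [aux_Hk_adj k hk]; simp [hxy]
    · apply hpar; simpa using h.symm
  · rw [← hxy] at h
    have hxy' := (aux_pre_suc k y x hk y.2 x.2).2 hxy
    refine (key y ⟨auxCh k y, (aux_lt k y hk y.2).2.2⟩ x ?_ ?_ ?_ ?_).symm
    · simp only [ne_eq, Fin.ext_iff]; omega
    · rw [aux_Hk_adj k hk]; simp
    · rw [aux_Hk_adj k hk]; simp [hxy']
    · apply hpar; simpa using h.symm

lemma aux_rows_of_cycle {V : Type*} [Fintype V] (k : ℕ) (hk : 2 ≤ k)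
    (G : SimpleGraph V) [DecidableRel G.Adj] (hreg : G.IsRegularOfDegree 3)
    (σ : V ≃ Fin (2 * k))
    (hc : ∀ x y : Fin (2 * k), y.val = auxSuc k x → G.Adj (σ.symm x) (σ.symm y))
    (x : Fin (2 * k)) : ∑ y, |signedAdj G (Hk k) σ x y| ≤ 2 := by
  classical
  have hb : ∀ y, |signedAdj G (Hk k) σ x y| ≤
      @ite ℝ (G.Adj (σ.symm x) (σ.symm y)) (Classical.propDecidable _) 1 0
      - (if y = ⟨auxSuc k x, (aux_lt k x hk x.2).1⟩ then 1 else 0)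
      - (if y = ⟨auxPre k x, (aux_lt k x hk x.2).2.1⟩ then 1 else 0)
      + (if y = ⟨auxCh k x, (aux_lt k x hk x.2).2.2⟩ then 1 else 0) := by
    intro y
    rw [aux_signedAdj, aux_Hk_row k hk]
    have d := aux_distinct k x hk x.2
    have h1 : y.val = auxSuc k x → G.Adj (σ.symm x) (σ.symm y) := hc x y
    have h2 : y.val = auxPre k x → G.Adj (σ.symm x) (σ.symm y) := fun h =>
      (hc y x ((aux_pre_suc k x y hk x.2 y.2).1 h)).symm
    simp only [Fin.ext_iff]
    by_cases e1 : y.val = auxSuc k x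
    · have e2 : y.val ≠ auxPre k x := by omega
      have e3 : y.val ≠ auxCh k x := by omega
      simp only [h1 e1, if_true, if_pos e1, if_neg e2, if_neg e3]; norm_num
    · by_cases e2 : y.val = auxPre k x
      · have e3 : y.val ≠ auxCh k x := by omega
        simp only [h2 e2, if_true, if_neg e1, if_pos e2, if_neg e3]; norm_num
      · simp only [if_neg e1, if_neg e2]
        split_ifs <;> norm_num
  refine le_trans (Finset.sum_le_sum fun y _ => hb y) ?_
  rw [Finset.sum_add_distrib, Finset.sum_sub_distrib, Finset.sum_sub_distrib, aux_G_row G hreg]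
  simp
  norm_num

/-- A cyclic labelling gives a Hamiltonian cycle. -/
lemma aux_ham_of_cycle {V : Type*} [Fintype V] [DecidableEq V] (k : ℕ) (hk : 2 ≤ k)
    (G : SimpleGraph V) (hcard : Fintype.card V = 2 * k) (σ : V ≃ Fin (2 * k))
    (hc : ∀ x y : Fin (2 * k), y.val = auxSuc k x → G.Adj (σ.symm x) (σ.symm y)) :
    G.IsHamiltonian := by
  intro _
  obtain ⟨n, hn⟩ : ∃ n, 2 * k = n + 3 := ⟨2 * k - 3, by omega⟩
  let e : Fin (n + 3) ≃ V := (finCongr hn.symm).trans σ.symm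
  have hadj : ∀ a b : Fin (n + 3), b - a = 1 → G.Adj (e a) (e b) := by
    intro a b h
    apply hc
    have hb : b = a + 1 := by rw [← h]; abel
    subst hb
    simp only [finCongr_apply, Fin.val_cast, Fin.val_add_one, auxSuc, Fin.ext_iff, Fin.val_last]
    split_ifs <;> omega
  let f : cycleGraph (n + 3) →g G :=
    { toFun := e
      map_rel' := by
        intro a b h
        rcases (cycleGraph_adj (n := n + 1)).1 h with h | h
        · exact (hadj _ _ h).symm
        · exact hadj _ _ h }
  refine ⟨_, (cycleGraph.cycle n).map f, ?_⟩
  rw [Walk.isHamiltonianCycle_iff_isCycle_and_length_eq]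
  refine ⟨(cycleGraph.isCycle_cycle).map e.injective, ?_⟩
  rw [Walk.length_map, cycleGraph.length_cycle, hcard, hn]

/-- A Hamiltonian cycle gives a cyclic labelling with `A` on the even labels. -/
lemma aux_cycle_of_ham {V : Type*} [Fintype V] [DecidableEq V] (k : ℕ) (hk : 2 ≤ k)
    (G : SimpleGraph V) (A : Finset V) (hcard : Fintype.card V = 2 * k) (hA : A.card = k)
    (halt : ∀ u v, G.Adj u v → (u ∈ A ↔ v ∉ A)) (hG : G.IsHamiltonian) :
    ∃ σ : V ≃ Fin (2 * k), InRes k A σ ∧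
      ∀ x y : Fin (2 * k), y.val = auxSuc k x → G.Adj (σ.symm x) (σ.symm y) := by
  have : Nontrivial V := Fintype.one_lt_card_iff_nontrivial.1 (by omega)
  obtain ⟨a, ha⟩ : A.Nonempty := Finset.card_pos.1 (by omega)
  obtain ⟨p, hp⟩ := hG.exists_isHamiltonianCycle a
  have hlen : p.length = 2 * k := by rw [hp.length_eq, hcard]
  let f : Fin (2 * k) → V := fun i => p.getVert i
  have hf : Function.Injective f := by
    intro i j hij
    have := hp.isCycle.getVert_injOn' (x₁ := i.val) (x₂ := j.val)
      (by show i.val ≤ p.length - 1; omega) (by show j.val ≤ p.length - 1; omega) hij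
    exact Fin.ext this
  have hbij : Function.Bijective f :=
    (Fintype.bijective_iff_injective_and_card f).2 ⟨hf, by simp [hcard]⟩
  have hpar : ∀ i, i ≤ 2 * k → (p.getVert i ∈ A ↔ i % 2 = 0) := by
    intro i
    induction i with
    | zero => intro _; simpa using ha
    | succ i ih =>
      intro hi
      have h1 := halt _ _ (p.adj_getVert_succ (i := i) (by omega))
      have h2 := ih (by omega)
      rw [h2] at h1
      by_cases h3 : p.getVert (i + 1) ∈ A
      · simp only [h3, not_true, iff_false] at h1
        simp only [h3, true_iff]; omega
      · simp only [h3, not_false_eq_true, iff_true] at h1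
        simp only [h3, false_iff]; omega
  refine ⟨(Equiv.ofBijective f hbij).symm, ?_, ?_⟩
  · intro v
    obtain ⟨i, rfl⟩ := hbij.surjective v
    rw [show (Equiv.ofBijective f hbij).symm (f i) = i from
      (Equiv.ofBijective f hbij).symm_apply_apply i]
    exact hpar i i.2.le
  · intro x y hxy
    show G.Adj (p.getVert x) (p.getVert y)
    have hadj := p.adj_getVert_succ (i := x.val) (by omega)
    unfold auxSuc at hxy
    split_ifs at hxy with h
    · rw [hxy, Walk.getVert_zero]
      rwa [show x.val + 1 = p.length by omega, Walk.getVert_length] at hadj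
    · rwa [hxy]

end Helpers

/-- Let `k ≥ 2` and `G` a 3-regular bipartite graph on `2k` vertices
with bipartition into independent sets `A, B` of size `k`. The following are equivalent:
(1) `G` has a Hamiltonian cycle; (2) some `σ ∈ Res(G, H_k)` has `‖abs(A(σ))‖₂ ≤ 2`;
(3) some `σ ∈ Res(G, H_k)` has `‖A(σ)‖₂ ≤ 2`, where `A(σ)` is the signed adjacency matrix
of the mismatch graph `G^σ − H_k` and `‖·‖₂` is the spectral norm. -/
theorem statement_15 {V : Type*} [Fintype V] [DecidableEq V] (k : ℕ) (hk : 2 ≤ k)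
    (G : SimpleGraph V) [DecidableRel G.Adj] (A B : Finset V)
    (hcard : Fintype.card V = 2 * k) (hA : A.card = k) (hB : B.card = k)
    (hUnion : ∀ v, v ∈ A ∨ v ∈ B) (hDisj : Disjoint A B)
    (hreg : G.IsRegularOfDegree 3)
    (hAind : ∀ u ∈ A, ∀ v ∈ A, ¬ G.Adj u v) (hBind : ∀ u ∈ B, ∀ v ∈ B, ¬ G.Adj u v) :
    (G.IsHamiltonian ↔
      ∃ σ : V ≃ Fin (2 * k), InRes k A σ ∧
        lpOpNorm 2 ((signedAdj G (Hk k) σ).map abs) ≤ 2) ∧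
    (G.IsHamiltonian ↔
      ∃ σ : V ≃ Fin (2 * k), InRes k A σ ∧ lpOpNorm 2 (signedAdj G (Hk k) σ) ≤ 2) := by
  have halt : ∀ u v, G.Adj u v → (u ∈ A ↔ v ∉ A) := by
    intro u v huv
    constructor
    · intro hu hv
      exact hAind u hu v hv huv
    · intro hv
      by_contra hu
      exact hBind u ((hUnion u).resolve_left hu) v ((hUnion v).resolve_left hv) huv
  have h12 : G.IsHamiltonian → ∃ σ : V ≃ Fin (2 * k), InRes k A σ ∧
      lpOpNorm 2 ((signedAdj G (Hk k) σ).map abs) ≤ 2 := by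
    intro hG
    obtain ⟨σ, hσ, hc⟩ := aux_cycle_of_ham k hk G A hcard hA halt hG
    refine ⟨σ, hσ, aux_lpOpNorm_le_of_rows _ ?_ ?_⟩
    · intro i j
      simp only [Matrix.map_apply]
      rw [aux_signedAdj_symm]
    · intro i
      simp only [Matrix.map_apply, abs_abs]
      exact aux_rows_of_cycle k hk G hreg σ hc i
  have h31 : (∃ σ : V ≃ Fin (2 * k), InRes k A σ ∧ lpOpNorm 2 (signedAdj G (Hk k) σ) ≤ 2) →
      G.IsHamiltonian := by
    rintro ⟨σ, hσ, hn⟩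
    refine aux_ham_of_cycle k hk G hcard σ (aux_cycle_of_norm k hk G hreg σ ?_ hn)
    intro x y hxy hadj
    have h1 := halt _ _ hadj
    rw [hσ, hσ] at h1
    simp only [Equiv.apply_symm_apply, hxy] at h1
    tauto
  have h23 : (∃ σ : V ≃ Fin (2 * k), InRes k A σ ∧
      lpOpNorm 2 ((signedAdj G (Hk k) σ).map abs) ≤ 2) →
      ∃ σ : V ≃ Fin (2 * k), InRes k A σ ∧ lpOpNorm 2 (signedAdj G (Hk k) σ) ≤ 2 := by
    rintro ⟨σ, hσ, hn⟩
    exact ⟨σ, hσ, aux_lpOpNorm_of_abs _ hn⟩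
  exact ⟨⟨h12, fun h => h31 (h23 h)⟩, ⟨fun h => h23 (h12 h), h31⟩⟩
end
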